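/- For probability distributions P and Q on a finite set, the total variation style bound ‖P - Q‖_1 ≤ √(2·D_KL(P‖Q)) holds, where ‖P - Q‖_1 = Σ_k |P_k - Q_k| and D_KL(P‖Q) = Σ_k P_k·log(P_k/Q_k). -/

import Mathlib

lemma pinsker_hasDeriv (t : ℝ) (ht : 0 < t) :
    HasDerivAt (fun t : ℝ => Real.log t - (5*t^2-4*t-1)/(2*t^2+4*t))
      ((t-1)^3/(t^2*(t+2)^2)) t := by
  have h1 := Real.hasDerivAt_log ht.ne'
  have hn : HasDerivAt (fun t : ℝ => 5*t^2-4*t-1) (10*t-4) t := by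
    have := (((hasDerivAt_pow 2 t).const_mul 5).sub ((hasDerivAt_id t).const_mul 4)).sub_const 1
    exact this.congr_deriv (by norm_num; ring)
  have hd : HasDerivAt (fun t : ℝ => 2*t^2+4*t) (4*t+4) t := by
    have := ((hasDerivAt_pow 2 t).const_mul 2).add ((hasDerivAt_id t).const_mul 4)
    exact this.congr_deriv (by norm_num; ring)
  have hne : 2*t^2+4*t ≠ 0 := by positivity
  have h := h1.sub (hn.div hd hne)
  refine h.congr_deriv ?_
  have e : 2*t^2+4*t = 2*(t*(t+2)) := by ring
  rw [e]
  have : t + 2 ≠ 0 := by positivity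
  field_simp
  ring

lemma pinsker_log (t : ℝ) (ht : 0 < t) :
    (5*t^2-4*t-1)/(2*t^2+4*t) ≤ Real.log t := by
  set D := (fun t : ℝ => Real.log t - (5*t^2-4*t-1)/(2*t^2+4*t)) with hD
  have h1 : D 1 = 0 := by simp [hD]; norm_num
  suffices 0 ≤ D t by simpa [hD] using this
  rw [← h1]
  rcases le_total 1 t with h | h
  · refine monotoneOn_of_deriv_nonneg (convex_Ici (1:ℝ)) (f := D) ?_ ?_ ?_ (by simp) h h
    · intro x hx
      exact (pinsker_hasDeriv x (lt_of_lt_of_le one_pos hx)).continuousAt.continuousWithinAt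
    · intro x hx
      rw [interior_Ici] at hx
      exact (pinsker_hasDeriv x (one_pos.trans hx)).differentiableAt.differentiableWithinAt
    · intro x hx
      rw [interior_Ici] at hx
      rw [(pinsker_hasDeriv x (one_pos.trans hx)).deriv]
      have : 0 ≤ x - 1 := sub_nonneg.2 (le_of_lt hx)
      positivity
  · refine antitoneOn_of_deriv_nonpos (convex_Ioc (0:ℝ) 1) (f := D) ?_ ?_ ?_ ⟨ht, h⟩ (by simp) h
    · intro x hx
      exact (pinsker_hasDeriv x hx.1).continuousAt.continuousWithinAt
    · intro x hx
      rw [interior_Ioc] at hx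
      exact (pinsker_hasDeriv x hx.1).differentiableAt.differentiableWithinAt
    · intro x hx
      rw [interior_Ioc] at hx
      rw [(pinsker_hasDeriv x hx.1).deriv]
      have : 0 ≤ 1 - x := sub_nonneg.2 hx.2.le
      have h3 : 0 ≤ (1-x)^3 := by positivity
      apply div_nonpos_of_nonpos_of_nonneg
      · nlinarith
      · positivity

lemma pinsker_point (p q : ℝ) (hp : 0 ≤ p) (hq : 0 ≤ q) (h : 0 < p → 0 < q) :
    0 ≤ p * Real.log (p/q) - p + q ∧
    (p-q)^2 ≤ ((2*p+4*q)/3) * (p * Real.log (p/q) - p + q) := by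
  rcases hp.eq_or_lt with rfl | hp'
  · simp only [zero_mul]
    constructor <;> nlinarith
  have hq' := h hp'
  have hl := pinsker_log (p/q) (div_pos hp' hq')
  have e : (5*(p/q)^2-4*(p/q)-1)/(2*(p/q)^2+4*(p/q)) = (p-q)*(5*p+q)/(2*p*(p+2*q)) := by
    field_simp
    ring
  rw [e] at hl
  have h2 : p * ((p-q)*(5*p+q)/(2*p*(p+2*q))) - p + q ≤ p * Real.log (p/q) - p + q := by
    gcongr
  have e2 : p * ((p-q)*(5*p+q)/(2*p*(p+2*q))) - p + q = 3*(p-q)^2/(2*(p+2*q)) := by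
    field_simp
    ring
  rw [e2] at h2
  refine ⟨le_trans (by positivity) h2, ?_⟩
  calc (p-q)^2 = ((2*p+4*q)/3) * (3*(p-q)^2/(2*(p+2*q))) := by field_simp; ring
    _ ≤ _ := by gcongr

/-- Pinsker's inequality for finite probability distributions:
`‖P - Q‖₁ ≤ √(2 D_KL(P‖Q))`. -/
theorem pinsker_finite {N : ℕ} (P Q : Fin N → ℝ)
    (hP0 : ∀ k, 0 ≤ P k) (hP1 : ∑ k, P k = 1)
    (hQ0 : ∀ k, 0 ≤ Q k) (hQ1 : ∑ k, Q k = 1)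
    (hsupp : ∀ k, 0 < P k → 0 < Q k) :
    ∑ k, |P k - Q k| ≤
      Real.sqrt (2 * ∑ k, P k * Real.log (P k / Q k)) := by
  have hpt := fun k => pinsker_point (P k) (Q k) (hP0 k) (hQ0 k) (hsupp k)
  have hf : ∀ k, 0 ≤ (2 * P k + 4 * Q k)/3 := fun k => by
    have := hP0 k
    have := hQ0 k
    positivity
  have hsf : ∑ k, (2 * P k + 4 * Q k)/3 = 2 := by
    rw [← Finset.sum_div, Finset.sum_add_distrib, ← Finset.mul_sum, ← Finset.mul_sum, hP1, hQ1]
    norm_num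
  have hsg : ∑ k, (P k * Real.log (P k / Q k) - P k + Q k) = ∑ k, P k * Real.log (P k / Q k) := by
    rw [Finset.sum_add_distrib, Finset.sum_sub_distrib, hP1, hQ1]
    ring
  calc ∑ k, |P k - Q k|
      ≤ ∑ k, √((2 * P k + 4 * Q k)/3) * √(P k * Real.log (P k / Q k) - P k + Q k) := by
        apply Finset.sum_le_sum
        intro k _
        rw [← Real.sqrt_mul (hf k)]
        exact Real.abs_le_sqrt (hpt k).2
    _ ≤ √(∑ k, (2 * P k + 4 * Q k)/3) * √(∑ k, (P k * Real.log (P k / Q k) - P k + Q k)) :=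
        Real.sum_sqrt_mul_sqrt_le _ hf (fun k => (hpt k).1)
    _ = _ := by
        rw [hsf, hsg, ← Real.sqrt_mul (by norm_num)]
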